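/- Symmetric characterization of the Bayesian order: for n ≥ 2 and x, y ∈ Δⁿ, x ⊑ y in the Bayesian order if and only if there is a permutation σ of {1, …, n} such that both x·σ and y·σ are monotone classical states (i.e. lie in Λⁿ) and (x·σ)_i (y·σ)_{i+1} ≤ (x·σ)_{i+1} (y·σ)_i for all i with 1 ≤ i < n. -/

import Mathlib

/-- `x` is a classical `n`-state: a point of the simplex
`Δⁿ = {x ∈ [0,1]ⁿ : Σᵢ xᵢ = 1}`. -/
def IsClassicalState (n : ℕ) (x : Fin n → ℝ) : Prop :=
  (∀ i, x i ∈ Set.Icc (0 : ℝ) 1) ∧ ∑ i, x i = 1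

/-- The Bayesian projection `pᵢ : Δ^{n+1} ⇀ Δⁿ`: remove coordinate `i` and
renormalize.  (It is intended to be applied only when `x i ≠ 1`.) -/
noncomputable def bayesProj {n : ℕ} (i : Fin (n + 1)) (x : Fin (n + 1) → ℝ) : Fin n → ℝ :=
  fun j => (1 - x i)⁻¹ * x (i.succAbove j)

/-- The Bayesian order on classical states, defined inductively: on `Δ²`,
`x ⊑ y` iff `(y₁ ≤ x₁ ≤ 1/2)` or `(1/2 ≤ x₁ ≤ y₁)`; on `Δ^{n+1}` (`n ≥ 2`),
`x ⊑ y` iff `pᵢ x ⊑ pᵢ y` whenever both projections are defined. -/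
def BayesLE : (n : ℕ) → (Fin n → ℝ) → (Fin n → ℝ) → Prop
  | 0, _, _ => True
  | 1, _, _ => True
  | 2, x, y => (y 0 ≤ x 0 ∧ x 0 ≤ 1 / 2) ∨ (1 / 2 ≤ x 0 ∧ x 0 ≤ y 0)
  | n + 3, x, y =>
      ∀ i : Fin (n + 3), x i ≠ 1 → y i ≠ 1 →
        BayesLE (n + 2) (bayesProj i x) (bayesProj i y)

/-- Along `(i, j)` both states decrease, and `y` decreases at least as fast as `x`. -/
def BayesDominates {n : ℕ} (x y : Fin n → ℝ) (i j : Fin n) : Prop :=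
  x j ≤ x i ∧ y j ≤ y i ∧ x i * y j ≤ x j * y i

theorem BayesDominates.refl {n : ℕ} (x y : Fin n → ℝ) (i : Fin n) : BayesDominates x y i i :=
  ⟨le_rfl, le_rfl, le_rfl⟩

theorem BayesDominates.trans {n : ℕ} {x y : Fin n → ℝ} (hx : ∀ i, 0 ≤ x i) (hy : ∀ i, 0 ≤ y i)
    {i j k : Fin n} (hij : BayesDominates x y i j) (hjk : BayesDominates x y j k) :
    BayesDominates x y i k := by
  obtain ⟨a1, a2, a3⟩ := hij
  obtain ⟨b1, b2, b3⟩ := hjk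
  refine ⟨b1.trans a1, b2.trans a2, ?_⟩
  rcases (hy j).eq_or_lt with hyj | hyj
  · have hyk : y k = 0 := le_antisymm (b2.trans_eq hyj.symm) (hy k)
    rw [hyk, mul_zero]
    exact mul_nonneg (hx k) (hy i)
  rcases (hx j).eq_or_lt with hxj | hxj
  · have hxi : x i = 0 := by
      rw [← hxj, zero_mul] at a3
      exact le_antisymm (nonpos_of_mul_nonpos_left a3 hyj) (hx i)
    rw [hxi, zero_mul]
    exact mul_nonneg (hx k) (hy i)
  · have h := mul_le_mul a3 b3 (mul_nonneg hxj.le (hy k)) (mul_nonneg hxj.le (hy i))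
    refine le_of_mul_le_mul_left ?_ (mul_pos hxj hyj)
    linarith

theorem bayesDominates_const_mul_iff {n : ℕ} {x y : Fin n → ℝ} {a b : ℝ} (ha : 0 < a) (hb : 0 < b)
    (i j : Fin n) :
    BayesDominates (fun k => a * x k) (fun k => b * y k) i j ↔ BayesDominates x y i j := by
  simp only [BayesDominates, mul_le_mul_iff_right₀ ha, mul_le_mul_iff_right₀ hb,
    mul_mul_mul_comm a _ b, mul_le_mul_iff_right₀ (mul_pos ha hb)]

theorem IsClassicalState.eq_zero_of_eq_one {n : ℕ} {x : Fin n → ℝ} (hx : IsClassicalState n x)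
    {i j : Fin n} (hi : x i = 1) (hij : j ≠ i) : x j = 0 := by
  have h := Finset.add_le_sum (fun k _ => (hx.1 k).1) (Finset.mem_univ i) (Finset.mem_univ j)
    hij.symm
  rw [hx.2, hi] at h
  linarith [(hx.1 j).1]

theorem IsClassicalState.one_sub_pos {n : ℕ} {x : Fin n → ℝ} (hx : IsClassicalState n x)
    {i : Fin n} (hi : x i ≠ 1) : 0 < 1 - x i :=
  sub_pos.2 (lt_of_le_of_ne (hx.1 i).2 hi)

theorem IsClassicalState.isClassicalState_bayesProj {n : ℕ} {x : Fin (n + 1) → ℝ}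
    (hx : IsClassicalState (n + 1) x) {i : Fin (n + 1)} (hi : x i ≠ 1) :
    IsClassicalState n (bayesProj i x) := by
  have hpos := hx.one_sub_pos hi
  have hnonneg : ∀ j, 0 ≤ bayesProj i x j := fun j =>
    mul_nonneg (inv_nonneg.2 hpos.le) (hx.1 _).1
  have hsum : ∑ j, bayesProj i x j = 1 := by
    have h := hx.2
    rw [Fin.sum_univ_succAbove _ i] at h
    simp only [bayesProj]
    rw [← Finset.mul_sum, eq_sub_of_add_eq' h, inv_mul_cancel₀ hpos.ne']
  exact ⟨fun j => ⟨hnonneg j,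
    hsum ▸ Finset.single_le_sum (fun k _ => hnonneg k) (Finset.mem_univ j)⟩, hsum⟩

theorem bayesLE_iff_forall_dominates : ∀ (n : ℕ) (x y : Fin (n + 2) → ℝ),
    IsClassicalState (n + 2) x → IsClassicalState (n + 2) y →
    (BayesLE (n + 2) x y ↔ ∀ i j, BayesDominates x y i j ∨ BayesDominates x y j i)
  | 0, x, y, hx, hy => by
    have hx1 : x 1 = 1 - x 0 := by linarith [hx.2, Fin.sum_univ_two x]
    have hy1 : y 1 = 1 - y 0 := by linarith [hy.2, Fin.sum_univ_two y]
    have h01 : BayesDominates x y 0 1 ↔ 1 / 2 ≤ x 0 ∧ x 0 ≤ y 0 := by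
      simp only [BayesDominates, hx1, hy1]
      constructor
      · rintro ⟨h1, -, h3⟩
        exact ⟨by linarith, by linarith⟩
      · rintro ⟨h1, h2⟩
        exact ⟨by linarith, by linarith, by linarith⟩
    have h10 : BayesDominates x y 1 0 ↔ y 0 ≤ x 0 ∧ x 0 ≤ 1 / 2 := by
      simp only [BayesDominates, hx1, hy1]
      constructor
      · rintro ⟨h1, -, h3⟩
        exact ⟨by linarith, by linarith⟩
      · rintro ⟨h1, h2⟩
        exact ⟨by linarith, by linarith, by linarith⟩
    simp only [BayesLE, ← h01, ← h10]
    refine Iff.trans ?_ (Fin.forall_fin_two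
      (p := fun i => ∀ j, BayesDominates x y i j ∨ BayesDominates x y j i)).symm
    rw [Fin.forall_fin_two, Fin.forall_fin_two]
    have h00 := BayesDominates.refl x y 0
    have h11 := BayesDominates.refl x y 1
    tauto
  | n + 1, x, y, hx, hy => by
    have key : ∀ i, x i ≠ 1 → y i ≠ 1 → (BayesLE (n + 2) (bayesProj i x) (bayesProj i y) ↔
        ∀ j k, BayesDominates x y (i.succAbove j) (i.succAbove k) ∨
          BayesDominates x y (i.succAbove k) (i.succAbove j)) := by
      intro i hxi hyi
      rw [bayesLE_iff_forall_dominates n _ _ (hx.isClassicalState_bayesProj hxi)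
        (hy.isClassicalState_bayesProj hyi)]
      have hscale := bayesDominates_const_mul_iff (x := fun k => x (i.succAbove k))
        (y := fun k => y (i.succAbove k)) (inv_pos.2 (hx.one_sub_pos hxi))
        (inv_pos.2 (hy.one_sub_pos hyi))
      exact forall₂_congr fun j k => or_congr (hscale j k) (hscale k j)
    simp only [BayesLE]
    constructor
    · intro h j k
      obtain ⟨i, hi⟩ : ∃ i, i ∉ ({j, k} : Finset (Fin (n + 3))) := by
        by_contra! hall
        have h1 := Finset.card_le_card (fun i _ => hall i : Finset.univ ⊆ ({j, k} : Finset _))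
        have h2 := Finset.card_le_two (a := j) (b := k)
        simp only [Finset.card_univ, Fintype.card_fin] at h1
        omega
      simp only [Finset.mem_insert, Finset.mem_singleton, not_or] at hi
      obtain ⟨hij, hik⟩ := hi
      by_cases hxi : x i = 1
      · simp [BayesDominates, hx.eq_zero_of_eq_one hxi (Ne.symm hij),
          hx.eq_zero_of_eq_one hxi (Ne.symm hik), le_total]
      by_cases hyi : y i = 1
      · simp [BayesDominates, hy.eq_zero_of_eq_one hyi (Ne.symm hij),
          hy.eq_zero_of_eq_one hyi (Ne.symm hik), le_total]
      obtain ⟨j, rfl⟩ := Fin.exists_succAbove_eq (Ne.symm hij)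
      obtain ⟨k, rfl⟩ := Fin.exists_succAbove_eq (Ne.symm hik)
      exact (key i hxi hyi).1 (h i hxi hyi) j k
    · exact fun h i hxi hyi => (key i hxi hyi).2 fun j k => h _ _

theorem exists_perm_dominates_iff {n : ℕ} {x y : Fin n → ℝ} (hx : ∀ i, 0 ≤ x i)
    (hy : ∀ i, 0 ≤ y i) :
    (∃ σ : Equiv.Perm (Fin n), ∀ (i : Fin n) (h : (i : ℕ) + 1 < n),
      BayesDominates x y (σ i) (σ ⟨(i : ℕ) + 1, h⟩)) ↔
    ∀ i j, BayesDominates x y i j ∨ BayesDominates x y j i := by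
  constructor
  · rintro ⟨σ, hσ⟩
    have hle : ∀ (i : Fin n) (d : ℕ) (h : (i : ℕ) + d < n),
        BayesDominates x y (σ i) (σ ⟨i + d, h⟩) := by
      intro i d
      induction d with
      | zero => exact fun _ => BayesDominates.refl x y _
      | succ d ih => exact fun h => (ih (by omega)).trans hx hy (hσ ⟨i + d, by omega⟩ h)
    have hmono : ∀ i j : Fin n, i ≤ j → BayesDominates x y (σ i) (σ j) := by
      intro i j hij
      have hadd : (i : ℕ) + (j - i) = j := Nat.add_sub_of_le hij
      convert hle i (j - i) (by omega) using 2
      exact Fin.ext hadd.symm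
    intro i j
    simpa using (le_total (σ.symm i) (σ.symm j)).imp (hmono _ _) (hmono _ _)
  · intro h
    refine ⟨Tuple.sort fun i => -(x i + y i), fun i hi => ?_⟩
    have hs := Tuple.monotone_sort (fun i => -(x i + y i))
      (show i ≤ ⟨(i : ℕ) + 1, hi⟩ from Nat.le_succ _)
    simp only [Function.comp_apply] at hs
    refine (h _ _).elim id fun ⟨h1, h2, _⟩ => ?_
    have hxe := le_antisymm h1 (by linarith)
    have hye := le_antisymm h2 (by linarith)
    simp only [BayesDominates, hxe, hye, le_refl, and_self]

/-- **Symmetric characterization of the Bayesian order.** For `n ≥ 2` and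
`x, y ∈ Δⁿ`: `x ⊑ y` iff there is a permutation `σ` of `{1,…,n}` such that both
`x·σ` and `y·σ` are monotone (decreasing) classical states, and
`(x·σ)ᵢ (y·σ)ᵢ₊₁ ≤ (x·σ)ᵢ₊₁ (y·σ)ᵢ` for all `i < n`. -/
theorem bayesLE_iff_symmetric (n : ℕ) (hn : 2 ≤ n)
    (x y : Fin n → ℝ) (hx : IsClassicalState n x) (hy : IsClassicalState n y) :
    BayesLE n x y ↔
      ∃ σ : Equiv.Perm (Fin n),
        (∀ (i : Fin n) (h : (i : ℕ) + 1 < n), x (σ ⟨(i : ℕ) + 1, h⟩) ≤ x (σ i)) ∧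
        (∀ (i : Fin n) (h : (i : ℕ) + 1 < n), y (σ ⟨(i : ℕ) + 1, h⟩) ≤ y (σ i)) ∧
        (∀ (i : Fin n) (h : (i : ℕ) + 1 < n),
          x (σ i) * y (σ ⟨(i : ℕ) + 1, h⟩) ≤ x (σ ⟨(i : ℕ) + 1, h⟩) * y (σ i)) := by
  obtain ⟨m, rfl⟩ := Nat.exists_eq_add_of_le' hn
  rw [bayesLE_iff_forall_dominates m x y hx hy,
    ← exists_perm_dominates_iff (fun i => (hx.1 i).1) (fun i => (hy.1 i).1)]
  simp only [BayesDominates, forall_and]
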